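/- Let X be a reflexive Banach space, A ⊆ X nonempty closed convex, and let f, g : A → (−∞,∞] be lower semicontinuous and convex, with f Gâteaux differentiable on A and f' continuous on A. Consider problem (MP'): minimize f + g over A. For ε > 0 set P(ε) := {x ∈ A : ⟨f'(x), x − y⟩ + g(x) − g(y) ≤ ε·T_M(y, x) for all y ∈ D_x}. Then problem (MP') is directionally Tykhonov well-posed with respect to M if and only if there exists x̄ ∈ ⋂_{ε>0} P(ε) such that f + g is bounded from below on D_x̄ and diam(P'(x̄, ε)) → 0 as ε → 0, where P'(x̄, ε) := {x ∈ D_x̄ : ⟨f'(x), x − y⟩ + g(x) − g(y) ≤ ε·T_M(x, y) for all y ∈ D_x̄}. -/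

import Mathlib

open Filter Topology Set
open scoped ENNReal

variable {X : Type*} [NormedAddCommGroup X] [NormedSpace ℝ X]

/-- The directional minimal time function `T_M(y,x) = inf {t ≥ 0 | ∃ m ∈ M, x = y + t•m}`,
with values in `[0,∞]` and `inf ∅ = ∞`. -/
noncomputable def minTime (M : Set X) (y x : X) : ℝ≥0∞ :=
  sInf {t : ℝ≥0∞ | ∃ r : ℝ, 0 ≤ r ∧ t = ENNReal.ofReal r ∧ ∃ m ∈ M, x = y + r • m}

/-- The cone generated by `M`: `cone(M) = {t•m | t ≥ 0, m ∈ M}`. -/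
def coneOf (M : Set X) : Set X := {p : X | ∃ t : ℝ, 0 ≤ t ∧ ∃ m ∈ M, p = t • m}

/-- `D_x := A ∩ dom T_M(·,x)`. -/
def Dset (M A : Set X) (x : X) : Set X := A ∩ {y : X | minTime M y x ≠ ⊤}

/-- Directional Tykhonov well-posedness of the problem of minimizing `F` over `A`. -/
def DirTykhonovWP (M A : Set X) (F : X → EReal) : Prop :=
  ∃ xb ∈ A, (∀ x ∈ Dset M A xb, F xb ≤ F x) ∧
    (∀ x ∈ Dset M A xb, F x = F xb → x = xb) ∧
    ∀ u : ℕ → X, (∀ k, u k ∈ Dset M A xb) →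
      Tendsto (fun k => F (u k)) atTop (𝓝 (F xb)) →
      Tendsto (fun k => minTime M (u k) xb) atTop (𝓝 0)

theorem ekeland_aux [CompleteSpace X] (D : Set X) (φ : X → ℝ) (b : ℝ) (hb : ∀ x ∈ D, b ≤ φ x)
    (hl : ∀ (u : ℕ → X) (x : X) (c : ℝ), (∀ n, u n ∈ D) → Tendsto u atTop (𝓝 x) →
      (∀ᶠ n in atTop, φ (u n) ≤ c) → x ∈ D ∧ φ x ≤ c)
    (ε : ℝ) (hε : 0 < ε) (x0 : X) (hx0 : x0 ∈ D) :
    ∃ z ∈ D, φ z + ε * dist x0 z ≤ φ x0 ∧ ∀ y ∈ D, φ z ≤ φ y + ε * dist y z := by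
  have hstep : ∀ (n : ℕ) (x : D), ∃ y : D, φ y + ε * dist (x : X) y ≤ φ x ∧
      ∀ w ∈ D, φ w + ε * dist (x : X) w ≤ φ x → φ y ≤ φ w + (1 / 2 : ℝ) ^ n := by
    intro n x
    let S : Set ℝ := φ '' {w | w ∈ D ∧ φ w + ε * dist (x : X) w ≤ φ x}
    have hne : S.Nonempty := ⟨φ x, x, ⟨x.2, by simp⟩, rfl⟩
    have hbd : BddBelow S := ⟨b, by rintro _ ⟨w, hw, rfl⟩; exact hb w hw.1⟩
    obtain ⟨_, ⟨y, hy, rfl⟩, hlt⟩ := exists_lt_of_csInf_lt hne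
      (show sInf S < sInf S + (1 / 2 : ℝ) ^ n by linarith [show (0 : ℝ) < (1 / 2 : ℝ) ^ n by positivity])
    refine ⟨⟨y, hy.1⟩, hy.2, fun w hw hw2 => ?_⟩
    have := csInf_le hbd (show φ w ∈ S from ⟨w, ⟨hw, hw2⟩, rfl⟩)
    simp only
    linarith
  choose nx h1 h2 using hstep
  let v : ℕ → D := fun n => Nat.rec ⟨x0, hx0⟩ (fun n x => nx n x) n
  have hv : ∀ n, v (n + 1) = nx n (v n) := fun n => rfl
  let u : ℕ → X := fun n => (v n).1
  have huD : ∀ n, u n ∈ D := fun n => (v n).2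
  have hmono : ∀ n k, φ (u (n + k)) + ε * dist (u n) (u (n + k)) ≤ φ (u n) := by
    intro n k
    induction k with
    | zero => simp
    | succ k ih =>
      have := h1 (n + k) (v (n + k))
      rw [← hv] at this
      change φ (u (n + k + 1)) + ε * dist (u (n + k)) (u (n + k + 1)) ≤ φ (u (n + k)) at this
      have ht := mul_le_mul_of_nonneg_left (dist_triangle (u n) (u (n + k)) (u (n + k + 1))) hε.le
      rw [← add_assoc]
      linarith
  have hanti : Antitone (fun n => φ (u n)) := by
    apply antitone_nat_of_succ_le
    intro n
    have := hmono n 1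
    have h0 : 0 ≤ ε * dist (u n) (u (n + 1)) := by positivity
    linarith
  have hbdd : BddBelow (range fun n => φ (u n)) := ⟨b, by rintro _ ⟨n, rfl⟩; exact hb _ (huD n)⟩
  have hL := tendsto_atTop_ciInf hanti hbdd
  set L := ⨅ n, φ (u n) with hLdef
  have hLle : ∀ n, L ≤ φ (u n) := fun n => ciInf_le hbdd n
  have hcau : CauchySeq u := by
    rw [Metric.cauchySeq_iff']
    intro δ hδ
    have : ∀ᶠ n in atTop, φ (u n) < L + ε * δ :=
      hL.eventually (gt_mem_nhds (by linarith [mul_pos hε hδ]))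
    obtain ⟨N, hN⟩ := this.exists
    refine ⟨N, fun n hn => ?_⟩
    obtain ⟨k, rfl⟩ := Nat.exists_eq_add_of_le hn
    have := hmono N k
    have := hLle (N + k)
    rw [dist_comm]
    have h3 : ε * dist (u N) (u (N + k)) < ε * δ := by linarith
    exact lt_of_mul_lt_mul_left h3 hε.le
  obtain ⟨z, hz⟩ := cauchySeq_tendsto_of_complete hcau
  have hzS : ∀ n, z ∈ D ∧ φ z + ε * dist (u n) z ≤ φ (u n) := by
    intro n
    have hlim : Tendsto (fun m => φ (u n) - ε * dist (u n) (u m)) atTop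
        (𝓝 (φ (u n) - ε * dist (u n) z)) :=
      tendsto_const_nhds.sub ((tendsto_const_nhds.dist hz).const_mul ε)
    have key : ∀ η > 0, z ∈ D ∧ φ z ≤ φ (u n) - ε * dist (u n) z + η := by
      intro η hη
      apply hl u z _ huD hz
      filter_upwards [hlim.eventually (gt_mem_nhds (show φ (u n) - ε * dist (u n) z <
        φ (u n) - ε * dist (u n) z + η by linarith)), eventually_ge_atTop n] with m hm hnm
      obtain ⟨k, rfl⟩ := Nat.exists_eq_add_of_le hnm
      linarith [hmono n k]
    refine ⟨(key 1 one_pos).1, ?_⟩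
    have := le_of_forall_pos_le_add fun η hη => (key η hη).2
    linarith
  refine ⟨z, (hzS 0).1, (hzS 0).2, fun y hy => ?_⟩
  by_contra! hlt
  have hzL : φ z ≤ L := le_ciInf fun n => by
    have h0 : 0 ≤ ε * dist (u n) z := by positivity
    linarith [(hzS n).2]
  have hyn : ∀ n, φ (u (n + 1)) ≤ φ y + (1 / 2 : ℝ) ^ n := by
    intro n
    have := h2 n (v n) y hy ?_
    · rw [← hv] at this; exact this
    · change φ y + ε * dist (u n) y ≤ φ (u n)
      have ht := mul_le_mul_of_nonneg_left (dist_triangle (u n) z y) hε.le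
      rw [dist_comm z y] at ht
      linarith [(hzS n).2]
  have hLy : L ≤ φ y := by
    have hp : Tendsto (fun n : ℕ => φ y + (1 / 2 : ℝ) ^ n) atTop (𝓝 (φ y + 0)) :=
      tendsto_const_nhds.add (tendsto_pow_atTop_nhds_zero_of_lt_one (by norm_num) (by norm_num))
    rw [add_zero] at hp
    exact ge_of_tendsto' hp fun n => (hLle (n + 1)).trans (hyn n)
  have h0 : 0 ≤ ε * dist y z := by positivity
  linarith

theorem le_minTime_aux (M : Set X) (hMsph : M ⊆ Metric.sphere (0 : X) 1) (y x : X) :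
    ENNReal.ofReal ‖x - y‖ ≤ minTime M y x := by
  refine le_sInf ?_
  rintro _ ⟨r, hr, rfl, m, hm, rfl⟩
  have : ‖m‖ = 1 := by simpa using hMsph hm
  simp [norm_smul, this, abs_of_nonneg hr]

theorem minTime_eq_aux (M : Set X) (hMsph : M ⊆ Metric.sphere (0 : X) 1) (y x : X)
    (h : x - y ∈ coneOf M) : minTime M y x = ENNReal.ofReal ‖x - y‖ := by
  refine le_antisymm (sInf_le ?_) (le_minTime_aux M hMsph y x)
  obtain ⟨t, ht, m, hm, he⟩ := h
  have : ‖m‖ = 1 := by simpa using hMsph hm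
  refine ⟨‖x - y‖, norm_nonneg _, rfl, m, hm, ?_⟩
  have h2 : ‖x - y‖ = t := by rw [he]; simp [norm_smul, this, abs_of_nonneg ht]
  rw [h2, ← he]; abel

theorem minTime_ne_top_aux (M : Set X) (hMsph : M ⊆ Metric.sphere (0 : X) 1) (y x : X) :
    minTime M y x ≠ ⊤ ↔ x - y ∈ coneOf M := by
  constructor
  · intro h
    obtain ⟨_, ⟨r, hr, rfl, m, hm, rfl⟩, -⟩ := sInf_lt_iff.1 (lt_top_iff_ne_top.2 h)
    exact ⟨r, hr, m, hm, by abel⟩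
  · intro h
    rw [minTime_eq_aux M hMsph y x h]
    exact ENNReal.ofReal_ne_top

theorem isClosed_cone_aux (M : Set X) (hMne : M.Nonempty) (hMcl : IsClosed M)
    (hMsph : M ⊆ Metric.sphere (0 : X) 1) : IsClosed (coneOf M) := by
  rw [← isSeqClosed_iff_isClosed]
  intro u p hu hp
  by_cases h0 : p = 0
  · obtain ⟨m, hm⟩ := hMne
    exact ⟨0, le_rfl, m, hm, by simp [h0]⟩
  · refine ⟨‖p‖, norm_nonneg _, ‖p‖⁻¹ • p, ?_, ?_⟩
    · have hn : ‖p‖ ≠ 0 := by simpa using h0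
      have hlim : Tendsto (fun n => ‖u n‖⁻¹ • u n) atTop (𝓝 (‖p‖⁻¹ • p)) :=
        (hp.norm.inv₀ hn).smul hp
      refine hMcl.mem_of_tendsto hlim ?_
      filter_upwards [hp.eventually_ne h0] with n hne
      obtain ⟨t, ht, m, hm, he⟩ := hu n
      have h1 : ‖m‖ = 1 := by simpa using hMsph hm
      have h2 : ‖u n‖ = t := by rw [he]; simp [norm_smul, h1, abs_of_nonneg ht]
      have h3 : t ≠ 0 := by rw [← h2]; simpa using hne
      rw [h2, he, smul_smul, inv_mul_cancel₀ h3, one_smul]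
      exact hm
    · rw [smul_smul, mul_inv_cancel₀ (by simpa using h0), one_smul]

/-- gradient inequality -/
theorem grad_aux (A : Set X) (f : X → ℝ) (hfconv : ConvexOn ℝ A f)
    (f' : X → (X →L[ℝ] ℝ))
    (hgat : ∀ x ∈ A, ∀ d : X,
      Tendsto (fun l : ℝ => (f (x + l • d) - f x) / l) (𝓝[≠] 0) (𝓝 (f' x d)))
    (x y : X) (hx : x ∈ A) (hy : y ∈ A) : f x - f y ≤ f' x (x - y) := by
  have h := (hgat x hx (y - x)).mono_left (nhdsWithin_mono 0 (show Ioi (0:ℝ) ⊆ {0}ᶜ from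
    fun l hl => ne_of_gt hl))
  have : f' x (y - x) ≤ f y - f x := by
    refine le_of_tendsto h ?_
    filter_upwards [Ioo_mem_nhdsGT (zero_lt_one' ℝ)] with l hl
    rw [div_le_iff₀ hl.1]
    have := hfconv.2 hx hy (sub_nonneg.2 hl.2.le) hl.1.le (by ring)
    rw [show (1 - l) • x + l • y = x + l • (y - x) by module] at this
    simp only [smul_eq_mul] at this
    linarith
  rw [← neg_sub y x, map_neg]; linarith

/-- first order condition -/
theorem first_order_aux (D : Set X) (f G : X → ℝ) (hG : ConvexOn ℝ D G)
    (f' : X → (X →L[ℝ] ℝ)) (z y : X) (hz : z ∈ D) (hy : y ∈ D)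
    (hgat : ∀ d : X,
      Tendsto (fun l : ℝ => (f (z + l • d) - f z) / l) (𝓝[≠] 0) (𝓝 (f' z d)))
    (c : ℝ) (hmin : ∀ y ∈ D, f z + G z ≤ f y + G y + c * dist y z) :
    f' z (z - y) + G z - G y ≤ c * ‖y - z‖ := by
  have h := (hgat (y - z)).mono_left (nhdsWithin_mono 0 (show Ioi (0:ℝ) ⊆ {0}ᶜ from
    fun l hl => ne_of_gt hl))
  have : G z - G y - c * ‖y - z‖ ≤ f' z (y - z) := by
    refine ge_of_tendsto h ?_
    filter_upwards [Ioo_mem_nhdsGT (zero_lt_one' ℝ)] with l hl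
    rw [le_div_iff₀ hl.1]
    have h1 := hG.2 hz hy (sub_nonneg.2 hl.2.le) hl.1.le (by ring)
    have h2 := hmin _ (hG.1 hz hy (sub_nonneg.2 hl.2.le) hl.1.le (by ring))
    rw [show (1 - l) • z + l • y = z + l • (y - z) by module] at h1 h2
    simp only [smul_eq_mul] at h1
    rw [dist_eq_norm, add_sub_cancel_left, norm_smul, Real.norm_of_nonneg hl.1.le] at h2
    linarith
  rw [← neg_sub y z, map_neg]; linarith

theorem ereal_aux (p q : EReal) (hp : p ≠ ⊥) (hp' : p ≠ ⊤) (hq : q ≠ ⊥) (hq' : q ≠ ⊤)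
    (a c : ℝ) (hc : 0 ≤ c) :
    (a : EReal) + p - q ≤ ((ENNReal.ofReal c : ℝ≥0∞) : EReal) ↔
      a + p.toReal - q.toReal ≤ c := by
  lift p to ℝ using ⟨hp', hp⟩
  lift q to ℝ using ⟨hq', hq⟩
  rw [EReal.coe_ennreal_ofReal, max_eq_left hc]
  simp only [EReal.toReal_coe]
  exact_mod_cast Iff.rfl

theorem ereal_aux2 (p q : EReal) (hq : q ≠ ⊥) (hq' : q ≠ ⊤)
    (a c : ℝ) (h : (a : EReal) + p - q ≤ ((ENNReal.ofReal c : ℝ≥0∞) : EReal)) : p ≠ ⊤ := by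
  rintro rfl
  lift q to ℝ using ⟨hq', hq⟩
  rw [EReal.coe_ennreal_ofReal, EReal.coe_add_top, EReal.top_sub_coe, top_le_iff] at h
  exact EReal.coe_ne_top _ h

theorem ereal_sub_top (p : EReal) : p - ⊤ = ⊥ := by
  rw [sub_eq_add_neg]; simp

/-- Theorem 3.6: characterization of the directional Tykhonov
well-posedness of (MP'): minimize `f + g` over `A`, via the sets `P(ε)`, `P'(x̄,ε)`. -/
theorem dirTykhonovWP_iff_P [CompleteSpace X]
    (hrefl : Function.Surjective ⇑(NormedSpace.inclusionInDoubleDual ℝ X))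
    (M : Set X) (hMne : M.Nonempty) (hMcl : IsClosed M)
    (hMsph : M ⊆ Metric.sphere (0 : X) 1) (hMcone : Convex ℝ (coneOf M))
    (A : Set X) (hAne : A.Nonempty) (hAcl : IsClosed A) (hAconv : Convex ℝ A)
    (f : X → ℝ) (hflsc : LowerSemicontinuousOn f A) (hfconv : ConvexOn ℝ A f)
    (g : X → EReal) (hgbot : ∀ x, g x ≠ ⊥) (hgproper : ∃ x ∈ A, g x ≠ ⊤)
    (hglsc : LowerSemicontinuousOn g A)
    (hgconv : ∀ x ∈ A, ∀ y ∈ A, ∀ a b : ℝ, 0 ≤ a → 0 ≤ b → a + b = 1 →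
      g (a • x + b • y) ≤ (a : EReal) * g x + (b : EReal) * g y)
    (f' : X → (X →L[ℝ] ℝ))
    (hgat : ∀ x ∈ A, ∀ d : X,
      Tendsto (fun l : ℝ => (f (x + l • d) - f x) / l) (𝓝[≠] 0) (𝓝 (f' x d)))
    (hf'cont : ContinuousOn f' A) :
    DirTykhonovWP M A (fun x => (f x : EReal) + g x) ↔
      ∃ xb,
        (∀ ε : ℝ, 0 < ε → xb ∈ {x ∈ A | ∀ y ∈ Dset M A x,
            ((f' x (x - y) : ℝ) : EReal) + g x - g y
              ≤ ((ENNReal.ofReal ε * minTime M y x : ℝ≥0∞) : EReal)}) ∧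
        (∃ b : ℝ, ∀ x ∈ Dset M A xb, (b : EReal) ≤ (f x : EReal) + g x) ∧
        Tendsto (fun ε : ℝ =>
            EMetric.diam {x ∈ Dset M A xb | ∀ y ∈ Dset M A xb,
              ((f' x (x - y) : ℝ) : EReal) + g x - g y
                ≤ ((ENNReal.ofReal ε * minTime M x y : ℝ≥0∞) : EReal)})
          (𝓝[>] 0) (𝓝 0) := by
  -- basic facts about D
  have hmT : ∀ x y, x - y ∈ coneOf M ↔ minTime M y x ≠ ⊤ := fun x y =>
    (minTime_ne_top_aux M hMsph y x).symm
  have hself : ∀ x ∈ A, x ∈ Dset M A x := by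
    intro x hx
    refine ⟨hx, ?_⟩
    change minTime M x x ≠ ⊤
    rw [← hmT]
    obtain ⟨m, hm⟩ := hMne
    exact ⟨0, le_rfl, m, hm, by simp⟩
  have hTD : ∀ x, ∀ y ∈ Dset M A x, minTime M y x = ENNReal.ofReal ‖x - y‖ := by
    intro x y hy
    exact minTime_eq_aux M hMsph y x ((hmT x y).2 hy.2)
  have hDconv : ∀ x, Convex ℝ (Dset M A x) := by
    intro x y hy z hz a b ha hb hab
    refine ⟨hAconv hy.1 hz.1 ha hb hab, ?_⟩
    change minTime M _ x ≠ ⊤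
    rw [← hmT]
    have := hMcone ((hmT x y).2 hy.2) ((hmT x z).2 hz.2) ha hb hab
    convert this using 1
    have : x = (a + b) • x := by rw [hab, one_smul]
    nth_rewrite 1 [this]
    module
  have hDcl : ∀ x, IsClosed (Dset M A x) := by
    intro x
    have : Dset M A x = A ∩ (fun y => x - y) ⁻¹' (coneOf M) := by
      ext y; simp only [Dset, mem_inter_iff, mem_ofPred_eq, mem_preimage, hmT]
    rw [this]
    exact hAcl.inter ((isClosed_cone_aux M hMne hMcl hMsph).preimage (by fun_prop))
  set G : X → ℝ := fun x => (g x).toReal with hGdef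
  have hgG : ∀ x, g x ≠ ⊤ → g x = (G x : EReal) := fun x hx => (EReal.coe_toReal hx (hgbot x)).symm
  have hGconv : ∀ x, ConvexOn ℝ {y ∈ Dset M A x | g y ≠ ⊤} G := by
    intro x
    have key : ∀ y ∈ {y ∈ Dset M A x | g y ≠ ⊤}, ∀ z ∈ {y ∈ Dset M A x | g y ≠ ⊤}, ∀ a b : ℝ,
        0 ≤ a → 0 ≤ b → a + b = 1 → g (a • y + b • z) ≤ ((a * G y + b * G z : ℝ) : EReal) := by
      intro y hy z hz a b ha hb hab
      have := hgconv y hy.1.1 z hz.1.1 a b ha hb hab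
      rw [hgG y hy.2, hgG z hz.2] at this
      exact_mod_cast this
    have hne : ∀ y ∈ {y ∈ Dset M A x | g y ≠ ⊤}, ∀ z ∈ {y ∈ Dset M A x | g y ≠ ⊤}, ∀ a b : ℝ,
        0 ≤ a → 0 ≤ b → a + b = 1 → g (a • y + b • z) ≠ ⊤ := by
      intro y hy z hz a b ha hb hab
      exact ne_top_of_le_ne_top (EReal.coe_ne_top _) (key y hy z hz a b ha hb hab)
    refine ⟨fun y hy z hz a b ha hb hab => ⟨hDconv x hy.1 hz.1 ha hb hab,
      hne y hy z hz a b ha hb hab⟩, fun y hy z hz a b ha hb hab => ?_⟩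
    have := key y hy z hz a b ha hb hab
    rw [hgG _ (hne y hy z hz a b ha hb hab)] at this
    exact_mod_cast this
  -- lower semicontinuity
  have hlsc : ∀ xb, ∀ (u : ℕ → X) (x : X) (c : ℝ),
      (∀ n, u n ∈ {y ∈ Dset M A xb | g y ≠ ⊤}) → Tendsto u atTop (𝓝 x) →
      (∀ᶠ n in atTop, f (u n) + G (u n) ≤ c) →
      x ∈ {y ∈ Dset M A xb | g y ≠ ⊤} ∧ f x + G x ≤ c := by
    intro xb u x c hu hux hc
    have hxD : x ∈ Dset M A xb := (hDcl xb).mem_of_tendsto hux (Eventually.of_forall fun n => (hu n).1)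
    have huA : Tendsto u atTop (𝓝[A] x) :=
      tendsto_nhdsWithin_iff.2 ⟨hux, Eventually.of_forall fun n => (hu n).1.1⟩
    have key : ∀ η > 0, g x ≤ ((c - f x + η : ℝ) : EReal) := by
      intro η hη
      by_contra! hlt
      have e1 := huA.eventually (hglsc x hxD.1 _ hlt)
      have e2 := huA.eventually (hflsc x hxD.1 (f x - η) (by linarith))
      obtain ⟨n, h1, h2, h3⟩ := (e1.and (e2.and hc)).exists
      rw [hgG _ (hu n).2] at h1
      have h1' : c - f x + η < G (u n) := by exact_mod_cast h1
      linarith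
    have hne : g x ≠ ⊤ := ne_top_of_le_ne_top (EReal.coe_ne_top _) (key 1 one_pos)
    refine ⟨⟨hxD, hne⟩, ?_⟩
    rw [hgG x hne] at key
    have := le_of_forall_pos_le_add (a := G x) (b := c - f x) fun η hη => by
      exact_mod_cast key η hη
    linarith
  have hgrad := grad_aux A f hfconv f' hgat
  -- minimality up to a Lipschitz term gives membership in P'
  have hP' : ∀ xb, ∀ z ∈ {y ∈ Dset M A xb | g y ≠ ⊤}, ∀ ε : ℝ, 0 ≤ ε →
      (∀ y ∈ {y ∈ Dset M A xb | g y ≠ ⊤}, f z + G z ≤ f y + G y + ε * dist y z) →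
      ∀ y ∈ Dset M A xb, ((f' z (z - y) : ℝ) : EReal) + g z - g y
        ≤ ((ENNReal.ofReal ε * ENNReal.ofReal ‖y - z‖ : ℝ≥0∞) : EReal) := by
    intro xb z hz ε hε hmin y hy
    by_cases hgy : g y = ⊤
    · rw [hgy, ereal_sub_top]; exact bot_le
    · rw [← ENNReal.ofReal_mul hε, ereal_aux _ _ (hgbot z) hz.2 (hgbot y) hgy _ _ (by positivity)]
      exact first_order_aux _ f G (hGconv xb) f' z y hz ⟨hy, hgy⟩ (hgat z hz.1.1) ε hmin
  have hF : ∀ x, g x ≠ ⊤ → (f x : EReal) + g x = ((f x + G x : ℝ) : EReal) := by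
    intro x hx
    rw [hgG x hx]; norm_cast
  have hFtop : ∀ x, g x = ⊤ → (f x : EReal) + g x = ⊤ := by
    intro x hx
    rw [hx, EReal.coe_add_top]
  constructor
  · rintro ⟨xb, hxA, hmin, huniq, hseq⟩
    refine ⟨xb, ?_, ?_, ?_⟩
    · intro ε hε
      refine ⟨hxA, fun y hy => ?_⟩
      by_cases hgt : g xb = ⊤
      · have h1 := hmin y hy
        simp only [hFtop xb hgt, top_le_iff] at h1
        have hgy : g y = ⊤ := by
          by_contra h
          rw [hF y h] at h1
          exact EReal.coe_ne_top _ h1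
        rw [hgy, ereal_sub_top]; exact bot_le
      · rw [hTD xb y hy, norm_sub_rev]
        refine hP' xb xb ⟨hself xb hxA, hgt⟩ ε hε.le (fun w hw => ?_) y hy
        have h1 := hmin w hw.1
        simp only [hF xb hgt, hF w hw.2] at h1
        have h2 : f xb + G xb ≤ f w + G w := by exact_mod_cast h1
        have : 0 ≤ ε * dist w xb := by positivity
        linarith
    · by_cases hgt : g xb = ⊤
      · refine ⟨0, fun x hx => ?_⟩
        have h1 := hmin x hx
        simp only [hFtop xb hgt, top_le_iff] at h1
        rw [h1]; exact le_top
      · refine ⟨f xb + G xb, fun x hx => ?_⟩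
        rw [← hF xb hgt]; exact hmin x hx
    · by_cases hgt : g xb = ⊤
      · have hsing : ∀ x ∈ Dset M A xb, x = xb := by
          intro x hx
          refine huniq x hx ?_
          have h1 := hmin x hx
          simp only [hFtop xb hgt, top_le_iff] at h1 ⊢
          exact h1
        refine tendsto_const_nhds.congr fun ε => ?_
        symm
        refine Metric.ediam_subsingleton ?_
        intro x hx y hy
        rw [hsing x hx.1, hsing y hy.1]
      · have hmin' : ∀ w ∈ {y ∈ Dset M A xb | g y ≠ ⊤}, f xb + G xb ≤ f w + G w := by
          intro w hw
          have h1 := hmin w hw.1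
          simp only [hF xb hgt, hF w hw.2] at h1
          exact_mod_cast h1
        have hxbD : xb ∈ {y ∈ Dset M A xb | g y ≠ ⊤} := ⟨hself xb hxA, hgt⟩
        -- main estimate
        have hest : ∀ ε : ℝ, 0 < ε → ∀ x ∈ {x ∈ Dset M A xb | ∀ y ∈ Dset M A xb,
              ((f' x (x - y) : ℝ) : EReal) + g x - g y
                ≤ ((ENNReal.ofReal ε * minTime M x y : ℝ≥0∞) : EReal)},
            g x ≠ ⊤ ∧ f x + G x ≤ f xb + G xb + ε * ‖xb - x‖ := by
          intro ε hε x hx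
          have h1 := hx.2 xb (hself xb hxA)
          rw [hTD xb x hx.1, ← ENNReal.ofReal_mul hε.le] at h1
          have h2 := ereal_aux2 _ _ (hgbot xb) hgt _ _ h1
          rw [ereal_aux _ _ (hgbot x) h2 (hgbot xb) hgt _ _ (by positivity)] at h1
          have h3 := hgrad x xb hx.1.1 hxA
          refine ⟨h2, ?_⟩
          change _ + G x - G xb ≤ _ at h1
          linarith
        have hball : ∀ δ : ℝ, 0 < δ → ∃ N : ℕ, ∀ ε : ℝ, 0 < ε → ε < 1 / ((N : ℝ) + 1) →
            ∀ x ∈ {x ∈ Dset M A xb | ∀ y ∈ Dset M A xb,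
              ((f' x (x - y) : ℝ) : EReal) + g x - g y
                ≤ ((ENNReal.ofReal ε * minTime M x y : ℝ≥0∞) : EReal)}, ‖xb - x‖ ≤ δ := by
          intro δ hδ
          by_contra! hcon
          choose e he0 he x hx hxδ using hcon
          let t : ℕ → ℝ := fun n => δ / ‖xb - x n‖
          have hpos : ∀ n, 0 < ‖xb - x n‖ := fun n => hδ.trans (hxδ n)
          have ht0 : ∀ n, 0 < t n := fun n => div_pos hδ (hpos n)
          have ht1 : ∀ n, t n ≤ 1 := fun n => (div_le_one (hpos n)).2 (hxδ n).le
          have htn : ∀ n, t n * ‖xb - x n‖ = δ := fun n => div_mul_cancel₀ _ (hpos n).ne'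
          let z : ℕ → X := fun n => (1 - t n) • xb + t n • x n
          have hxn : ∀ n, x n ∈ {y ∈ Dset M A xb | g y ≠ ⊤} := fun n =>
            ⟨(hx n).1, (hest _ (he0 n) _ (hx n)).1⟩
          have hzD : ∀ n, z n ∈ {y ∈ Dset M A xb | g y ≠ ⊤} := fun n =>
            (hGconv xb).1 hxbD (hxn n) (sub_nonneg.2 (ht1 n)) (ht0 n).le (by ring)
          have hzle : ∀ n, f (z n) + G (z n) ≤ f xb + G xb + (1 / ((n : ℝ) + 1)) * δ := by
            intro n
            have h1 := (hGconv xb).2 hxbD (hxn n) (sub_nonneg.2 (ht1 n)) (ht0 n).le (by ring)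
            have h2 := hfconv.2 hxA (hxn n).1.1 (sub_nonneg.2 (ht1 n)) (ht0 n).le (by ring)
            simp only [smul_eq_mul] at h1 h2
            have h3 := mul_le_mul_of_nonneg_left (hest _ (he0 n) _ (hx n)).2 (ht0 n).le
            have h4 : t n * (e n * ‖xb - x n‖) = e n * δ := by rw [← htn n]; ring
            have h5 := mul_le_mul_of_nonneg_right (he n).le hδ.le
            change f (z n) ≤ _ at h2
            change G (z n) ≤ _ at h1
            rw [mul_add (t n) (f xb + G xb), h4] at h3
            linarith
          have hlim : Tendsto (fun n => f (z n) + G (z n)) atTop (𝓝 (f xb + G xb)) := by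
            refine tendsto_of_tendsto_of_tendsto_of_le_of_le tendsto_const_nhds ?_
              (fun n => hmin' _ (hzD n)) hzle
            have := (tendsto_one_div_add_atTop_nhds_zero_nat (𝕜 := ℝ)).mul_const δ
            simpa using this.const_add (f xb + G xb)
          have h1 := hseq z (fun n => (hzD n).1) (by
            simp only [hF xb hgt]
            refine ((continuous_coe_real_ereal.tendsto _).comp hlim).congr fun n => ?_
            simp only [Function.comp_apply, hF _ (hzD n).2])
          have h2 : ∀ n, minTime M (z n) xb = ENNReal.ofReal δ := by
            intro n
            rw [hTD xb _ (hzD n).1]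
            congr 1
            have : xb - z n = t n • (xb - x n) := by simp only [z]; module
            rw [this, norm_smul, Real.norm_of_nonneg (ht0 n).le, htn]
          simp only [h2] at h1
          have h3 := tendsto_nhds_unique h1 tendsto_const_nhds
          rw [eq_comm, ENNReal.ofReal_eq_zero] at h3
          linarith
        rw [ENNReal.tendsto_nhds_zero]
        intro r hr
        obtain ⟨δ, hδ, hδr⟩ : ∃ δ : ℝ, 0 < δ ∧ ENNReal.ofReal (2 * δ) ≤ r := by
          by_cases hrt : r = ⊤
          · exact ⟨1, one_pos, by rw [hrt]; exact le_top⟩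
          · refine ⟨r.toReal / 2, half_pos (ENNReal.toReal_pos hr.ne' hrt), ?_⟩
            rw [mul_div_cancel₀ _ two_ne_zero, ENNReal.ofReal_toReal hrt]
        obtain ⟨N, hN⟩ := hball δ hδ
        filter_upwards [Ioo_mem_nhdsGT (show (0 : ℝ) < 1 / ((N : ℝ) + 1) by positivity)] with ε hε
        refine le_trans (Metric.ediam_le fun x hx y hy => ?_) hδr
        rw [edist_dist]
        apply ENNReal.ofReal_le_ofReal
        have h1 := hN ε hε.1 hε.2 x hx
        have h2 := hN ε hε.1 hε.2 y hy
        have h3 := dist_triangle_left x y xb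
        rw [dist_eq_norm xb, dist_eq_norm xb] at h3
        linarith
  · rintro ⟨xb, hP, -, hdiam⟩
    have hxA : xb ∈ A := (hP 1 one_pos).1
    have hxD := hself xb hxA
    by_cases hgt : g xb = ⊤
    · have htop : ∀ y ∈ Dset M A xb, g y = ⊤ := by
        intro y hy
        by_contra h
        have h1 := (hP 1 one_pos).2 y hy
        rw [hTD xb y hy, ← ENNReal.ofReal_mul zero_le_one] at h1
        exact ereal_aux2 _ _ (hgbot y) h _ _ h1 hgt
      have hsing : ∀ y ∈ Dset M A xb, y = xb := by
        intro y hy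
        have hle : edist y xb ≤ 0 := by
          refine ge_of_tendsto hdiam (Eventually.of_forall fun ε => ?_)
          refine Metric.edist_le_ediam_of_mem ⟨hy, fun w hw => ?_⟩ ⟨hxD, fun w hw => ?_⟩
          · rw [htop w hw, ereal_sub_top]; exact bot_le
          · rw [htop w hw, ereal_sub_top]; exact bot_le
        exact edist_le_zero.1 hle
      refine ⟨xb, hxA, fun x hx => ?_, fun x hx _ => hsing x hx, fun u hu _ => ?_⟩
      · rw [hsing x hx]
      · refine tendsto_const_nhds.congr fun n => ?_
        rw [hTD xb _ (hu n), hsing _ (hu n)]; simp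
    · have hxbD : xb ∈ {y ∈ Dset M A xb | g y ≠ ⊤} := ⟨hxD, hgt⟩
      have hmin' : ∀ w ∈ {y ∈ Dset M A xb | g y ≠ ⊤}, f xb + G xb ≤ f w + G w := by
        intro w hw
        have h1 : ∀ ε > 0, f' xb (xb - w) + G xb - G w ≤ ε * ‖xb - w‖ := by
          intro ε hε
          have h1 := (hP ε hε).2 w hw.1
          rw [hTD xb w hw.1, ← ENNReal.ofReal_mul hε.le,
            ereal_aux _ _ (hgbot xb) hgt (hgbot w) hw.2 _ _ (by positivity)] at h1
          exact h1
        have h2 : f' xb (xb - w) + G xb - G w ≤ 0 := by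
          have hl : Tendsto (fun ε : ℝ => ε * ‖xb - w‖) (𝓝[>] 0) (𝓝 (0 * ‖xb - w‖)) :=
            (tendsto_id.mono_left nhdsWithin_le_nhds).mul_const _
          rw [zero_mul] at hl
          exact ge_of_tendsto hl (by filter_upwards [self_mem_nhdsWithin] with ε hε using h1 ε hε)
        have h3 := hgrad xb w hxA hw.1.1
        linarith
      have hmem : ∀ z ∈ {y ∈ Dset M A xb | g y ≠ ⊤}, ∀ ε : ℝ, 0 ≤ ε →
          (∀ y ∈ {y ∈ Dset M A xb | g y ≠ ⊤}, f z + G z ≤ f y + G y + ε * dist y z) →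
          z ∈ {x ∈ Dset M A xb | ∀ y ∈ Dset M A xb,
              ((f' x (x - y) : ℝ) : EReal) + g x - g y
                ≤ ((ENNReal.ofReal ε * minTime M x y : ℝ≥0∞) : EReal)} := by
        intro z hz ε hε hm
        refine ⟨hz.1, fun y hy => (hP' xb z hz ε hε hm y hy).trans ?_⟩
        rw [EReal.coe_ennreal_le_coe_ennreal_iff]
        gcongr
        exact le_minTime_aux M hMsph z y
      have hxbmem : ∀ ε : ℝ, 0 ≤ ε → _ := fun ε hε => hmem xb hxbD ε hε (fun y hy => by
        have : 0 ≤ ε * dist y xb := by positivity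
        linarith [hmin' y hy])
      refine ⟨xb, hxA, fun x hx => ?_, fun x hx hxe => ?_, fun u hu hlim => ?_⟩
      · by_cases hgx : g x = ⊤
        · simp only [hFtop x hgx]; exact le_top
        · simp only [hF x hgx, hF xb hgt]
          exact_mod_cast hmin' x ⟨hx, hgx⟩
      · have hgx : g x ≠ ⊤ := by
          intro h
          simp only [hFtop x h, hF xb hgt] at hxe
          exact EReal.coe_ne_top _ hxe.symm
        simp only [hF x hgx, hF xb hgt] at hxe
        have hxe' : f x + G x = f xb + G xb := by exact_mod_cast hxe
        have hle : edist x xb ≤ 0 := by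
          refine ge_of_tendsto hdiam ?_
          filter_upwards [self_mem_nhdsWithin] with ε hε
          have hε' : (0 : ℝ) ≤ ε := le_of_lt hε
          refine Metric.edist_le_ediam_of_mem (hmem x ⟨hx, hgx⟩ ε hε' fun y hy => ?_) (hxbmem ε hε')
          have : 0 ≤ ε * dist y x := by positivity
          linarith [hmin' y hy]
        exact edist_le_zero.1 hle
      · have hd : Tendsto u atTop (𝓝 xb) := by
          rw [Metric.tendsto_nhds]
          intro δ hδ
          have e1 := hdiam.eventually (gt_mem_nhds
            (show (0 : ℝ≥0∞) < ENNReal.ofReal (δ / 2) by simpa using hδ))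
          obtain ⟨ε, hε1, hε0, hε2⟩ := (e1.and (Ioo_mem_nhdsGT (half_pos hδ))).exists
          simp only [hF xb hgt] at hlim
          have e2 := hlim.eventually (gt_mem_nhds (show ((f xb + G xb : ℝ) : EReal) <
            ((f xb + G xb + ε * ε : ℝ) : EReal) by
              exact_mod_cast lt_add_of_pos_right _ (mul_pos hε0 hε0)))
          filter_upwards [e2] with k hk
          have hgk : g (u k) ≠ ⊤ := by
            intro h
            rw [hFtop _ h] at hk
            exact not_top_lt hk
          rw [hF _ hgk] at hk
          have hk' : f (u k) + G (u k) < f xb + G xb + ε * ε := by exact_mod_cast hk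
          obtain ⟨z, hz, hz1, hz2⟩ := ekeland_aux {y ∈ Dset M A xb | g y ≠ ⊤}
            (fun x => f x + G x) (f xb + G xb) hmin' (hlsc xb) ε hε0 (u k) ⟨hu k, hgk⟩
          have h1 := hmin' z hz
          have h2 : ε * dist (u k) z < ε * ε := by linarith
          have h3 : dist (u k) z < ε := lt_of_mul_lt_mul_left h2 hε0.le
          have h4 := (Metric.edist_le_ediam_of_mem (hmem z hz ε hε0.le hz2)
            (hxbmem ε hε0.le)).trans_lt hε1
          rw [edist_dist, ENNReal.ofReal_lt_ofReal_iff (half_pos hδ)] at h4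
          have h5 := dist_triangle (u k) z xb
          linarith
        have h1 : Tendsto (fun k => ENNReal.ofReal ‖xb - u k‖) atTop (𝓝 (ENNReal.ofReal ‖xb - xb‖)) :=
          ENNReal.tendsto_ofReal ((tendsto_const_nhds.sub hd).norm)
        simp only [sub_self, norm_zero, ENNReal.ofReal_zero] at h1
        exact h1.congr fun k => (hTD xb _ (hu k)).symm
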